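/- arXiv:1408.4133 — 2 statements merged into one kernel-verified Lean document; each statement's English description precedes it below -/
import Mathlib

section
/- Let σ be a finite sequence of natural numbers in sawtooth form. If G(σ) contains an unpierced box or an unpierced hexagon of type 1 or type 2, then G(σ) contains an empty unpierced box or an empty unpierced hexagon of type 1 or type 2. -/
/-- A finite sequence of natural numbers is in sawtooth form if whenever an entry
is less than the next one, the next one is exactly one more. -/
def Sawtooth (σ : List ℕ) : Prop :=
  ∀ i : ℕ, i + 1 < σ.length →
    σ.getD i 0 < σ.getD (i + 1) 0 → σ.getD (i + 1) 0 = σ.getD i 0 + 1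

/-- A commutation swaps two adjacent entries whose values differ by more than 1. -/
def Commutation (σ τ : List ℕ) : Prop :=
  ∃ (l r : List ℕ) (x y : ℕ),
    (x + 1 < y ∨ y + 1 < x) ∧ σ = l ++ x :: y :: r ∧ τ = l ++ y :: x :: r

/-- `(i, j)` is a dot of the dot graph `G(σ)` (the first coordinate is 1-based). -/
def IsDot (σ : List ℕ) (i j : ℤ) : Prop :=
  ∃ k : Fin σ.length, i = ((k : ℕ) : ℤ) + 1 ∧ j = ((σ.get k : ℕ) : ℤ)

/-- The dots `(a, y), (a+1, y+1), …, (a+t, y+t)` all belong to `G(σ)`; equivalently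
(for `0 ≤ t`) the dots `(a, y)` and `(a+t, y+t)` lie on a common ascending segment. -/
def OnAsc (σ : List ℕ) (a y t : ℤ) : Prop :=
  ∀ s : ℤ, 0 ≤ s → s ≤ t → IsDot σ (a + s) (y + s)

/-- The dots `(a, y), …, (a+m, y+m)` form an entire (i.e. maximal) ascending segment. -/
def IsAscSeg (σ : List ℕ) (a y : ℤ) (m : ℕ) : Prop :=
  OnAsc σ a y (m : ℤ) ∧ ¬ IsDot σ (a - 1) (y - 1) ∧
    ¬ IsDot σ (a + (m : ℤ) + 1) (y + (m : ℤ) + 1)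

/-- A box of `G(σ)` with lower horizontal edge from `(a, y)` to `(b, y)` and
ascending edges of length `t`. -/
def IsBox (σ : List ℕ) (a b y t : ℤ) : Prop :=
  0 ≤ t ∧ a + t < b ∧
  OnAsc σ a y t ∧ ¬ IsDot σ (a + t + 1) (y + t + 1) ∧
  OnAsc σ b y t ∧ ¬ IsDot σ (b - 1) (y - 1)

/-- No dot of `G(σ)` lies in the open interior of either horizontal edge of the box. -/
def BoxUnpierced (σ : List ℕ) (a b y t : ℤ) : Prop :=
  (∀ i : ℤ, a < i → i < b → ¬ IsDot σ i y) ∧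
  (∀ i : ℤ, a + t < i → i < b + t → ¬ IsDot σ i (y + t))

/-- No dot of `G(σ)` lies in the open interior of the box. -/
def BoxEmpty (σ : List ℕ) (a b y t : ℤ) : Prop :=
  ∀ i h : ℤ, y < h → h < y + t → a + (h - y) < i → i < b + (h - y) → ¬ IsDot σ i h

/-- The closed region of the box. -/
def BoxRegion (a b y t : ℤ) : Set (ℤ × ℤ) :=
  {p | y ≤ p.2 ∧ p.2 ≤ y + t ∧ a + (p.2 - y) ≤ p.1 ∧ p.1 ≤ b + (p.2 - y)}

/-- A hexagon of type 1 of `G(σ)`. -/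
def IsHex1 (σ : List ℕ) (a b c y L M : ℤ) : Prop :=
  0 ≤ M ∧ M ≤ L ∧ a < b ∧ b + M < c ∧
  OnAsc σ a y L ∧ ¬ IsDot σ (a + L + 1) (y + L + 1) ∧
  OnAsc σ b y M ∧ ¬ IsDot σ (b - 1) (y - 1) ∧ ¬ IsDot σ (b + M + 1) (y + M + 1) ∧
  OnAsc σ c (y + M) (L - M)

/-- No dot of `G(σ)` lies in the open interior of any of the three horizontal
edges of the type 1 hexagon. -/
def Hex1Unpierced (σ : List ℕ) (a b c y L M : ℤ) : Prop :=
  (∀ i : ℤ, a < i → i < b → ¬ IsDot σ i y) ∧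
  (∀ i : ℤ, b + M < i → i < c → ¬ IsDot σ i (y + M)) ∧
  (∀ i : ℤ, a + L < i → i < c + L - M → ¬ IsDot σ i (y + L))

/-- The open interior of the type 1 hexagon. -/
def Hex1Interior (a b c y L M : ℤ) : Set (ℤ × ℤ) :=
  {p | y < p.2 ∧ p.2 < y + L ∧ a + (p.2 - y) < p.1 ∧
    (p.2 ≤ y + M → p.1 < b + (p.2 - y)) ∧ (y + M ≤ p.2 → p.1 < c + (p.2 - y - M))}

/-- No dot of `G(σ)` lies in the open interior of the type 1 hexagon. -/
def Hex1Empty (σ : List ℕ) (a b c y L M : ℤ) : Prop :=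
  ∀ p ∈ Hex1Interior a b c y L M, ¬ IsDot σ p.1 p.2

/-- The closed region of the type 1 hexagon (open interior together with its
horizontal and ascending edges). -/
def Hex1Region (a b c y L M : ℤ) : Set (ℤ × ℤ) :=
  {p | y ≤ p.2 ∧ p.2 ≤ y + L ∧ a + (p.2 - y) ≤ p.1 ∧
    (p.2 < y + M → p.1 ≤ b + (p.2 - y)) ∧ (y + M ≤ p.2 → p.1 ≤ c + (p.2 - y - M))}

/-- A hexagon of type 2 of `G(σ)`. -/
def IsHex2 (σ : List ℕ) (p q r y L M : ℤ) : Prop :=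
  0 ≤ M ∧ M ≤ L ∧ p < q ∧ p + (L - M) < r ∧ r + M < q + L ∧
  OnAsc σ p y (L - M) ∧
  OnAsc σ r (y + L - M) M ∧ ¬ IsDot σ (r - 1) (y + L - M - 1) ∧
    ¬ IsDot σ (r + M + 1) (y + L + 1) ∧
  OnAsc σ q y L ∧ ¬ IsDot σ (q - 1) (y - 1)

/-- No dot of `G(σ)` lies in the open interior of any of the three horizontal
edges of the type 2 hexagon. -/
def Hex2Unpierced (σ : List ℕ) (p q r y L M : ℤ) : Prop :=
  (∀ i : ℤ, p < i → i < q → ¬ IsDot σ i y) ∧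
  (∀ i : ℤ, p + (L - M) < i → i < r → ¬ IsDot σ i (y + L - M)) ∧
  (∀ i : ℤ, r + M < i → i < q + L → ¬ IsDot σ i (y + L))

/-- The open interior of the type 2 hexagon. -/
def Hex2Interior (p q r y L M : ℤ) : Set (ℤ × ℤ) :=
  {x | y < x.2 ∧ x.2 < y + L ∧ x.1 < q + (x.2 - y) ∧
    (x.2 ≤ y + L - M → p + (x.2 - y) < x.1) ∧
    (y + L - M ≤ x.2 → r + (x.2 - y - L + M) < x.1)}

/-- No dot of `G(σ)` lies in the open interior of the type 2 hexagon. -/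
def Hex2Empty (σ : List ℕ) (p q r y L M : ℤ) : Prop :=
  ∀ x ∈ Hex2Interior p q r y L M, ¬ IsDot σ x.1 x.2

/-- The closed region of the type 2 hexagon (open interior together with its
horizontal and ascending edges). -/
def Hex2Region (p q r y L M : ℤ) : Set (ℤ × ℤ) :=
  {x | y ≤ x.2 ∧ x.2 ≤ y + L ∧ x.1 ≤ q + (x.2 - y) ∧
    (x.2 ≤ y + L - M → p + (x.2 - y) ≤ x.1) ∧
    (y + L - M < x.2 → r + (x.2 - y - L + M) ≤ x.1)}

/-- The number of dots of `G(σ)` lying in a region `R`. -/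
noncomputable def DotsIn (σ : List ℕ) (R : Set (ℤ × ℤ)) : ℕ :=
  {p : ℤ × ℤ | IsDot σ p.1 p.2 ∧ p ∈ R}.ncard

/-- A region `RQ` is strictly inside a region `RP` (with respect to `G(σ)`) if
`RQ ⊆ RP` and `RQ` contains strictly fewer dots of `G(σ)` than `RP`. -/
def StrictlyInside (σ : List ℕ) (RQ RP : Set (ℤ × ℤ)) : Prop :=
  RQ ⊆ RP ∧ DotsIn σ RQ < DotsIn σ RP

/-- A dot graph polygon: a box, a hexagon of type 1, or a hexagon of type 2. -/
inductive DGPoly : Type where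
  | box (a b y t : ℤ)
  | hex1 (a b c y L M : ℤ)
  | hex2 (p q r y L M : ℤ)

/-- The polygon is genuinely a box/hexagon of type 1/hexagon of type 2 of `G(σ)`. -/
def DGPoly.Valid (σ : List ℕ) : DGPoly → Prop
  | .box a b y t => IsBox σ a b y t
  | .hex1 a b c y L M => IsHex1 σ a b c y L M
  | .hex2 p q r y L M => IsHex2 σ p q r y L M

/-- The polygon is unpierced. -/
def DGPoly.Unpierced (σ : List ℕ) : DGPoly → Prop
  | .box a b y t => BoxUnpierced σ a b y t
  | .hex1 a b c y L M => Hex1Unpierced σ a b c y L M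
  | .hex2 p q r y L M => Hex2Unpierced σ p q r y L M

/-- The polygon is empty. -/
def DGPoly.IsEmpty (σ : List ℕ) : DGPoly → Prop
  | .box a b y t => BoxEmpty σ a b y t
  | .hex1 a b c y L M => Hex1Empty σ a b c y L M
  | .hex2 p q r y L M => Hex2Empty σ p q r y L M

/-- The closed region of the polygon. -/
def DGPoly.Region : DGPoly → Set (ℤ × ℤ)
  | .box a b y t => BoxRegion a b y t
  | .hex1 a b c y L M => Hex1Region a b c y L M
  | .hex2 p q r y L M => Hex2Region p q r y L M

/-- On the columns `a, …, b` the sequence `f` climbs by one at each step. -/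
def IsRun (f : ℤ → ℤ) (a b : ℤ) : Prop :=
  ∀ i, a ≤ i → i ≤ b → f i = f a + (i - a)

/-- An unpierced box, with ascending edges over the columns `a, …, a'` and `b, …, b'`. -/
structure SeqBox (f : ℤ → ℤ) (a a' b b' : ℤ) : Prop where
  le_left : a ≤ a'
  lt : a' < b
  le_right : b ≤ b'
  run_left : IsRun f a a'
  run_right : IsRun f b b'
  bot : f b = f a
  top : f b' = f a'
  between : ∀ i, a' < i → i < b → f a < f i ∧ f i < f a'

/-- An unpierced hexagon of type 1, with ascending edges over the columns `a, …, a'`,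
`b, …, b'` and `c, …, c'`. -/
structure SeqHex1 (f : ℤ → ℤ) (a a' b b' c c' : ℤ) : Prop where
  le_left : a ≤ a'
  lt_left : a' < b
  le_mid : b ≤ b'
  lt_right : b' < c
  le_right : c ≤ c'
  run_left : IsRun f a a'
  run_mid : IsRun f b b'
  run_right : IsRun f c c'
  bot : f b = f a
  mid : f c = f b'
  top : f c' = f a'
  height_lt : f b' < f a'
  between_left : ∀ i, a' < i → i < b → f a < f i ∧ f i < f a'
  between_right : ∀ i, b' < i → i < c → f i < f b'

/-- An unpierced hexagon of type 2, with ascending edges over the columns `p, …, p'`,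
`r, …, r'` and `q, …, q'`. -/
structure SeqHex2 (f : ℤ → ℤ) (p p' r r' q q' : ℤ) : Prop where
  le_left : p ≤ p'
  lt_left : p' < r
  le_mid : r ≤ r'
  lt_right : r' < q
  le_right : q ≤ q'
  run_left : IsRun f p p'
  run_mid : IsRun f r r'
  run_right : IsRun f q q'
  bot : f q = f p
  mid : f r = f p'
  top : f q' = f r'
  height_lt : f p < f r
  between_left : ∀ i, p' < i → i < r → f r < f i
  between_right : ∀ i, r' < i → i < q → f q < f i ∧ f i < f r'

/-- Some empty unpierced box or hexagon has its ascending edges over columns in `[l, u]`. -/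
def HasEmptyPolygon (f : ℤ → ℤ) (l u : ℤ) : Prop :=
  (∃ a a' b', l ≤ a ∧ b' ≤ u ∧ SeqBox f a a' (a' + 1) b') ∨
  (∃ a a' b' c c', l ≤ a ∧ c' ≤ u ∧ SeqHex1 f a a' (a' + 1) b' c c') ∨
  (∃ p p' r r' q', l ≤ p ∧ q' ≤ u ∧ SeqHex2 f p p' r r' (r' + 1) q')

/-- The sequence obtained by a half-turn of the dot graph. -/
def halfTurn (f : ℤ → ℤ) (i : ℤ) : ℤ := -f (-i)

theorem halfTurn_halfTurn (f : ℤ → ℤ) : halfTurn (halfTurn f) = f := by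
  funext i
  simp [halfTurn]

theorem halfTurn_step {f : ℤ → ℤ} (hf : ∀ i, f (i + 1) ≤ f i + 1) (i : ℤ) :
    halfTurn f (i + 1) ≤ halfTurn f i + 1 := by
  have h := hf (-(i + 1))
  rw [show -(i + 1) + 1 = -i by ring] at h
  simp only [halfTurn]
  omega

theorem HasEmptyPolygon.mono {f : ℤ → ℤ} {l u l' u' : ℤ} (h : HasEmptyPolygon f l u)
    (hl : l' ≤ l) (hu : u ≤ u') : HasEmptyPolygon f l' u' := by
  rcases h with ⟨a, a', b', h1, h2, h⟩ | ⟨a, a', b', c, c', h1, h2, h⟩ |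
    ⟨p, p', r, r', q', h1, h2, h⟩
  · exact Or.inl ⟨a, a', b', by omega, by omega, h⟩
  · exact Or.inr (Or.inl ⟨a, a', b', c, c', by omega, by omega, h⟩)
  · exact Or.inr (Or.inr ⟨p, p', r, r', q', by omega, by omega, h⟩)

theorem IsRun.halfTurn {f : ℤ → ℤ} {a b : ℤ} (h : IsRun f a b) :
    IsRun (halfTurn f) (-b) (-a) := by
  intro i h1 h2
  have e1 := h (-i) (by omega) (by omega)
  have e2 := h b (by omega) (by omega)
  simp only [_root_.halfTurn, neg_neg]
  omega

theorem IsRun.sub {f : ℤ → ℤ} {a b a' b' : ℤ} (h : IsRun f a b) (ha : a ≤ a') (hb : b' ≤ b) :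
    IsRun f a' b' := by
  intro i h1 h2
  have e1 := h i (by omega) (by omega)
  have e2 := h a' (by omega) (by omega)
  omega

theorem SeqBox.halfTurn {f : ℤ → ℤ} {a a' b b' : ℤ} (h : SeqBox f a a' b b') :
    SeqBox (halfTurn f) (-b') (-b) (-a') (-a) := by
  obtain ⟨h1, h2, h3, r1, r2, e1, e2, hb⟩ := h
  refine ⟨by omega, by omega, by omega, r2.halfTurn, r1.halfTurn, ?_, ?_, ?_⟩
  · simp [_root_.halfTurn, e2]
  · simp [_root_.halfTurn, e1]
  · intro i hi hi'
    have := hb (-i) (by omega) (by omega)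
    simp only [_root_.halfTurn, neg_neg]
    omega

theorem SeqHex1.halfTurn {f : ℤ → ℤ} {a a' b b' c c' : ℤ} (h : SeqHex1 f a a' b b' c c') :
    SeqHex2 (halfTurn f) (-c') (-c) (-b') (-b) (-a') (-a) := by
  obtain ⟨h1, h2, h3, h4, h5, r1, r2, r3, e1, e2, e3, hl, hb, hb'⟩ := h
  refine ⟨by omega, by omega, by omega, by omega, by omega, r3.halfTurn, r2.halfTurn,
    r1.halfTurn, ?_, ?_, ?_, ?_, ?_, ?_⟩
  · simp [_root_.halfTurn, e3]
  · simp [_root_.halfTurn, e2]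
  · simp [_root_.halfTurn, e1]
  · simp only [_root_.halfTurn, neg_neg]
    omega
  · intro i hi hi'
    have := hb' (-i) (by omega) (by omega)
    simp only [_root_.halfTurn, neg_neg]
    omega
  · intro i hi hi'
    have := hb (-i) (by omega) (by omega)
    simp only [_root_.halfTurn, neg_neg]
    omega

theorem SeqHex2.halfTurn {f : ℤ → ℤ} {p p' r r' q q' : ℤ} (h : SeqHex2 f p p' r r' q q') :
    SeqHex1 (halfTurn f) (-q') (-q) (-r') (-r) (-p') (-p) := by
  obtain ⟨h1, h2, h3, h4, h5, r1, r2, r3, e1, e2, e3, hl, hb, hb'⟩ := h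
  refine ⟨by omega, by omega, by omega, by omega, by omega, r3.halfTurn, r2.halfTurn,
    r1.halfTurn, ?_, ?_, ?_, ?_, ?_, ?_⟩
  · simp [_root_.halfTurn, e3]
  · simp [_root_.halfTurn, e2]
  · simp [_root_.halfTurn, e1]
  · simp only [_root_.halfTurn, neg_neg]
    omega
  · intro i hi hi'
    have := hb' (-i) (by omega) (by omega)
    simp only [_root_.halfTurn, neg_neg]
    omega
  · intro i hi hi'
    have := hb (-i) (by omega) (by omega)
    simp only [_root_.halfTurn, neg_neg]
    omega

theorem HasEmptyPolygon.of_halfTurn {f : ℤ → ℤ} {l u : ℤ}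
    (h : HasEmptyPolygon (halfTurn f) (-u) (-l)) : HasEmptyPolygon f l u := by
  have key : ∀ x : ℤ, -x = -(x + 1) + 1 := fun x => by ring
  rcases h with ⟨a, a', b', h1, h2, h⟩ | ⟨a, a', b', c, c', h1, h2, h⟩ |
    ⟨p, p', r, r', q', h1, h2, h⟩
  · have := h.halfTurn
    rw [halfTurn_halfTurn, key a'] at this
    exact Or.inl ⟨_, _, _, by omega, by omega, this⟩
  · have := h.halfTurn
    rw [halfTurn_halfTurn, key a'] at this
    exact Or.inr (Or.inr ⟨_, _, _, _, _, by omega, by omega, this⟩)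
  · have := h.halfTurn
    rw [halfTurn_halfTurn, key r'] at this
    exact Or.inr (Or.inl ⟨_, _, _, _, _, by omega, by omega, this⟩)

theorem exists_last {P : ℤ → Prop} {l u j : ℤ} (h1 : l ≤ j) (h2 : j ≤ u) (hj : P j) :
    ∃ k, l ≤ k ∧ k ≤ u ∧ P k ∧ ∀ i, k < i → i ≤ u → ¬ P i := by
  obtain ⟨k, hk, hmax⟩ := Int.exists_greatest_of_bdd
    (P := fun z => l ≤ z ∧ z ≤ u ∧ P z) ⟨u, fun z hz => hz.2.1⟩ ⟨j, h1, h2, hj⟩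
  refine ⟨k, hk.1, hk.2.1, hk.2.2, fun i hi hi' hP => ?_⟩
  have := hmax i ⟨by omega, hi', hP⟩
  omega

theorem exists_last_max (f : ℤ → ℤ) {l u : ℤ} (h : l ≤ u) :
    ∃ k, l ≤ k ∧ k ≤ u ∧ (∀ i, l ≤ i → i ≤ u → f i ≤ f k) ∧ ∀ i, k < i → i ≤ u → f i < f k := by
  obtain ⟨m, hm, hmax⟩ := Finset.exists_max_image (Finset.Icc l u) f ⟨l, by simp [h]⟩
  simp only [Finset.mem_Icc] at hm hmax
  obtain ⟨k, h1, h2, h3, h4⟩ := exists_last (P := fun i => f i = f m) hm.1 hm.2 rfl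
  refine ⟨k, h1, h2, fun i hi hi' => h3 ▸ hmax i ⟨hi, hi'⟩, fun i hi hi' => ?_⟩
  have := hmax i ⟨by omega, hi'⟩
  have := h4 i hi hi'
  omega

/-- A run extended as far to the right as possible. -/
theorem exists_run_end {f : ℤ → ℤ} {l u : ℤ} (hlu : l ≤ u) (h : ¬ IsRun f l u) :
    ∃ e, l ≤ e ∧ e < u ∧ IsRun f l e ∧ f (e + 1) ≠ f e + 1 := by
  obtain ⟨e, h1, h2, h3, h4⟩ := exists_last (P := fun e => IsRun f l e) le_rfl hlu
    (fun i hi hi' => by rw [show i = l by omega]; ring)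
  have hne : e ≠ u := fun he => h (he ▸ h3)
  refine ⟨e, h1, by omega, h3, fun heq => h4 (e + 1) (by omega) (by omega) fun i hi hi' => ?_⟩
  rcases hi'.lt_or_eq with hlt | rfl
  · exact h3 i hi (by omega)
  · have := h3 e h1 le_rfl
    omega

/-- A run extended as far to the left as possible. -/
theorem exists_run_start {f : ℤ → ℤ} {l u : ℤ} (hlu : l ≤ u) (h : ¬ IsRun f l u) :
    ∃ s, l < s ∧ s ≤ u ∧ IsRun f s u ∧ f s ≠ f (s - 1) + 1 := by
  have h' : ¬ IsRun (halfTurn f) (-u) (-l) := fun hr => h <| by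
    simpa only [halfTurn_halfTurn, neg_neg] using hr.halfTurn
  obtain ⟨e, h1, h2, h3, h4⟩ := exists_run_end (by omega) h'
  refine ⟨-e, by omega, by omega, ?_, fun heq => h4 ?_⟩
  · simpa only [halfTurn_halfTurn, neg_neg] using h3.halfTurn
  · simp only [halfTurn]
    rw [show -(e + 1) = -e - 1 by ring]
    omega

/-- In every window of width less than `n`, a value that recurs at the foot of a run, with only
intermediate values in between, forces an empty polygon. -/
def RecurrenceBelow (n : ℤ) : Prop :=
  ∀ (f : ℤ → ℤ) (l q u : ℤ), (∀ i, f (i + 1) ≤ f i + 1) → u - l < n → l < q → q ≤ u →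
    f l = f q → IsRun f q u → (∀ i, l < i → i < q → f l < f i ∧ f i ≤ f u) →
    HasEmptyPolygon f l u

theorem run_below_of_max {n : ℤ} (ih : RecurrenceBelow n) {f : ℤ → ℤ}
    (hf : ∀ i, f (i + 1) ≤ f i + 1) {l k : ℤ} (hlk : l < k) (hn : k - l ≤ n)
    (hmax : ∀ i, l < i → i < k → f i ≤ f k) (hrun : ¬ IsRun f l k) :
    HasEmptyPolygon f l k ∨
      ∃ s, l < s ∧ s ≤ k ∧ IsRun f s k ∧ ∀ i, l < i → i < s → f s < f i := by
  obtain ⟨s, h1, h2, h3, h4⟩ := exists_run_start hlk.le hrun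
  by_cases hlow : ∀ i, l < i → i < s → f s < f i
  · exact Or.inr ⟨s, h1, h2, h3, hlow⟩
  push Not at hlow
  obtain ⟨j, hj1, hj2, hj3⟩ := hlow
  obtain ⟨m, hm1, hm2, hm3, hm4⟩ :=
    exists_last (P := fun i => f i ≤ f s) (u := s - 1) (le_refl j) (by omega) hj3
  have hms : f m = f s := by
    rcases hm2.lt_or_eq with hlt | rfl
    · have := hf m
      have := hm4 (m + 1) (by omega) (by omega)
      omega
    · have := hf (s - 1)
      rw [sub_add_cancel] at this
      omega
  refine Or.inl ((ih f m s k hf (by omega) (by omega) h2 hms h3 fun i hi hi' => ?_).mono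
    (by omega) le_rfl)
  have := hm4 i hi (by omega)
  have := hmax i (by omega) (by omega)
  omega

theorem run_above_of_min {n : ℤ} (ih : RecurrenceBelow n) {f : ℤ → ℤ}
    (hf : ∀ i, f (i + 1) ≤ f i + 1) {k u : ℤ} (hku : k < u) (hn : u - k ≤ n)
    (hmin : ∀ i, k < i → i < u → f k ≤ f i) (hrun : ¬ IsRun f k u) :
    HasEmptyPolygon f k u ∨
      ∃ e, k ≤ e ∧ e < u ∧ IsRun f k e ∧ ∀ i, e < i → i < u → f i < f e := by
  have hmax : ∀ i, -u < i → i < -k → halfTurn f i ≤ halfTurn f (-k) := fun i hi hi' => by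
    have := hmin (-i) (by omega) (by omega)
    simp only [halfTurn, neg_neg]
    omega
  have hrun' : ¬ IsRun (halfTurn f) (-u) (-k) := fun hr => hrun <| by
    simpa only [halfTurn_halfTurn, neg_neg] using hr.halfTurn
  rcases run_below_of_max ih (halfTurn_step hf) (by omega) (by omega) hmax hrun' with
    h | ⟨s, h1, h2, h3, h4⟩
  · exact Or.inl h.of_halfTurn
  · refine Or.inr ⟨-s, by omega, by omega, ?_, fun i hi hi' => ?_⟩
    · simpa only [halfTurn_halfTurn, neg_neg] using h3.halfTurn
    · have := h4 (-i) (by omega) (by omega)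
      simp only [halfTurn, neg_neg] at this
      omega

/-- In every window of width less than `n`, an unpierced hexagon of type 1 forces an empty
polygon. -/
def Hex1Below (n : ℤ) : Prop :=
  ∀ (f : ℤ → ℤ) (a a' b b' c c' : ℤ), (∀ i, f (i + 1) ≤ f i + 1) → c' - a < n →
    SeqHex1 f a a' b b' c c' → HasEmptyPolygon f a c'

/-- In every window of width less than `n`, an unpierced hexagon of type 2 forces an empty
polygon. -/
def Hex2Below (n : ℤ) : Prop :=
  ∀ (f : ℤ → ℤ) (p p' r r' q q' : ℤ), (∀ i, f (i + 1) ≤ f i + 1) → q' - p < n →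
    SeqHex2 f p p' r r' q q' → HasEmptyPolygon f p q'

theorem Hex2Below.hex1Below {n : ℤ} (h : Hex2Below n) : Hex1Below n := by
  intro f a a' b b' c c' hf hn hh
  exact (h _ _ _ _ _ _ _ (halfTurn_step hf) (by omega) hh.halfTurn).of_halfTurn

/-- The values strictly between two runs `[a, a']` and `[b, b']` with the same top produce a
hexagon of type 1 ending at the top of the second run. -/
theorem hex1_of_between {n : ℤ} (ihA : RecurrenceBelow n) {f : ℤ → ℤ}
    (hf : ∀ i, f (i + 1) ≤ f i + 1) {a a' b b' : ℤ} (haa : a ≤ a') (hab : a' + 1 < b)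
    (hbb : b ≤ b') (hn : b' - a ≤ n) (ra : IsRun f a a') (rb : IsRun f b b') (ht : f b' = f a')
    (hbet : ∀ i, a' < i → i < b → f a ≤ f i ∧ f b < f i ∧ f i < f a') :
    HasEmptyPolygon f a b' ∨
      ∃ a₁ s k c, a ≤ a₁ ∧ a' < s ∧ s ≤ k ∧ k < b ∧ f s = f a₁ ∧
        SeqHex1 f a₁ a' s k c b' := by
  obtain ⟨k, k1, k2, k3, k4⟩ := exists_last_max f (l := a' + 1) (u := b - 1) (by omega)
  have hk := hbet k (by omega) (by omega)
  rcases run_below_of_max ihA hf (l := a') (k := k) (by omega) (by omega)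
    (fun i hi hi' => k3 i (by omega) (by omega))
    (fun hr => by have := hr k (by omega) le_rfl; omega) with h | ⟨s, s1, s2, s3, s4⟩
  · exact Or.inl (h.mono (by omega) (by omega))
  have hs := hbet s (by omega) (by omega)
  have ea' := ra a' haa le_rfl
  have eb' := rb b' hbb le_rfl
  have es := s3 k s2 le_rfl
  have ea₁ := ra (a + (f s - f a)) (by omega) (by omega)
  have ec := rb (b + (f k - f b)) (by omega) (by omega)
  refine Or.inr ⟨a + (f s - f a), s, k, b + (f k - f b), by omega, s1, s2, by omega, by omega,
    by omega, by omega, s2, by omega, by omega, ra.sub (by omega) le_rfl, s3,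
    rb.sub (by omega) le_rfl, by omega, by omega, by omega, by omega, ?_, ?_⟩
  · intro i hi hi'
    have := s4 i hi hi'
    have := hbet i hi (by omega)
    omega
  · intro i hi hi'
    by_cases hib : i < b
    · exact k4 i hi (by omega)
    · have := rb i (by omega) (by omega)
      omega

theorem SeqBox.hasEmptyPolygon {n : ℤ} (ihA : RecurrenceBelow n) (ih1 : Hex1Below n)
    {f : ℤ → ℤ} (hf : ∀ i, f (i + 1) ≤ f i + 1) {a a' b b' : ℤ} (hn : b' - a ≤ n)
    (h : SeqBox f a a' b b') : HasEmptyPolygon f a b' := by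
  by_cases he : b = a' + 1
  · subst he
    exact Or.inl ⟨_, _, _, le_rfl, le_rfl, h⟩
  obtain ⟨h1, h2, h3, ra, rb, e1, e2, hb⟩ := h
  rcases hex1_of_between ihA hf h1 (by omega) h3 hn ra rb e2
    (fun i hi hi' => by have := hb i hi hi'; omega) with h | ⟨a₁, s, k, c, g1, g2, g3, g4, g5, g⟩
  · exact h
  have := hb s (by omega) (by omega)
  have hne : a ≠ a₁ := fun h => by rw [← h] at g5; omega
  exact (ih1 f _ _ _ _ _ _ hf (by omega) g).mono g1 le_rfl

theorem exists_first_min (f : ℤ → ℤ) {l u : ℤ} (h : l ≤ u) :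
    ∃ k, l ≤ k ∧ k ≤ u ∧ (∀ i, l ≤ i → i ≤ u → f k ≤ f i) ∧ ∀ i, l ≤ i → i < k → f k < f i := by
  obtain ⟨k, h1, h2, h3, h4⟩ := exists_last_max (halfTurn f) (l := -u) (u := -l) (by omega)
  simp only [halfTurn] at h3 h4
  refine ⟨-k, by omega, by omega, fun i hi hi' => ?_, fun i hi hi' => ?_⟩
  · have := h3 (-i) (by omega) (by omega)
    simp only [neg_neg] at this
    omega
  · have := h4 (-i) (by omega) (by omega)
    simp only [neg_neg] at this
    omega

theorem SeqHex2.hasEmptyPolygon {n : ℤ} (ihA : RecurrenceBelow n) (ih2 : Hex2Below n)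
    {f : ℤ → ℤ} (hf : ∀ i, f (i + 1) ≤ f i + 1) {p p' r r' q q' : ℤ} (hn : q' - p ≤ n)
    (h : SeqHex2 f p p' r r' q q') : HasEmptyPolygon f p q' := by
  by_cases he : q = r' + 1
  · subst he
    exact Or.inr (Or.inr ⟨_, _, _, _, _, le_rfl, le_rfl, h⟩)
  obtain ⟨h1, h2, h3, h4, h5, rp, rr, rq, e1, e2, e3, hl, hb, hb'⟩ := h
  have ep' := rp p' h1 le_rfl
  have er' := rr r' h3 le_rfl
  have eq' := rq q' h5 le_rfl
  obtain ⟨k, k1, k2, k3, k4⟩ := exists_first_min f (l := r' + 1) (u := q - 1) (by omega)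
  have hk := hb' k (by omega) (by omega)
  by_cases hcase : f r ≤ f k
  · rcases hex1_of_between ihA hf h3 (by omega) h5 (by omega) rr rq e3
      (fun i hi hi' => by
        have := hb' i hi hi'
        have := k3 i (by omega) (by omega)
        omega) with h | ⟨a₁, s, k', c, g1, g2, g3, g4, g5, g⟩
    · exact h.mono (by omega) le_rfl
    · exact (ih2.hex1Below f _ _ _ _ _ _ hf (by omega) g).mono (by omega) le_rfl
  rcases run_above_of_min ihA hf (k := k) (u := q) (by omega) (by omega)
    (fun i hi hi' => k3 i (by omega) (by omega))
    (fun hr => by have := hr q (by omega) le_rfl; omega) with h | ⟨e, s1, s2, s3, s4⟩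
  · exact h.mono (by omega) (by omega)
  have ee := s3 e s1 le_rfl
  have hbe := hb' e (by omega) (by omega)
  have ep₁ := rp (p + (f k - f p)) (by omega) (by omega)
  have eq₁ := rq (q + (f e - f q)) (by omega) (by omega)
  refine (ih2 f p (p + (f k - f p)) k e q (q + (f e - f q)) hf (by omega)
    ⟨by omega, by omega, s1, s2, by omega, rp.sub le_rfl (by omega), s3,
      rq.sub le_rfl (by omega), e1, by omega, by omega, by omega, ?_, ?_⟩).mono le_rfl (by omega)
  · intro i hi hi'
    by_cases c1 : i ≤ p'
    · have := rp i (by omega) c1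
      omega
    by_cases c2 : i < r
    · have := hb i (by omega) c2
      omega
    by_cases c3 : i ≤ r'
    · have := rr i (by omega) c3
      omega
    · exact k4 i (by omega) hi'
  · intro i hi hi'
    exact ⟨(hb' i (by omega) hi').1, s4 i hi hi'⟩

theorem recurrence_hasEmptyPolygon {n : ℤ} (ihA : RecurrenceBelow n) (ih2 : Hex2Below n)
    {f : ℤ → ℤ} {l q u : ℤ} (hf : ∀ i, f (i + 1) ≤ f i + 1) (hn : u - l ≤ n) (hlq : l < q)
    (hqu : q ≤ u) (e1 : f l = f q) (rq : IsRun f q u)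
    (hb : ∀ i, l < i → i < q → f l < f i ∧ f i ≤ f u) : HasEmptyPolygon f l u := by
  have eu := rq u hqu le_rfl
  obtain ⟨e, he1, he2, re, he3⟩ := exists_run_end (f := f) hlq.le
    (fun hr => by have := hr q hlq.le le_rfl; omega)
  have ee := re e he1 le_rfl
  obtain ⟨k, k1, k2, k3, k4⟩ := exists_last_max f (l := l) (u := q - 1) (by omega)
  have hku : f l ≤ f k ∧ f k ≤ f u := by
    rcases k1.lt_or_eq with hlt | rfl
    · have := hb k hlt (by omega)
      omega
    · omega
  have eq₁ := rq (q + (f k - f l)) (by omega) (by omega)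
  have hafter : ∀ i, k < i → i < q → f l < f i ∧ f i < f k := fun i hi hi' =>
    ⟨(hb i (by omega) hi').1, k4 i hi (by omega)⟩
  by_cases hke : k ≤ e
  · have ek := re k k1 hke
    exact (SeqBox.hasEmptyPolygon ihA ih2.hex1Below hf (a' := k) (b' := q + (f k - f l))
      (by omega) ⟨k1, by omega, by omega, re.sub le_rfl hke, rq.sub le_rfl (by omega), e1.symm,
        by omega, hafter⟩).mono le_rfl (by omega)
  have hfe := hf e
  rcases run_below_of_max ihA hf (l := e) (k := k) (by omega) (by omega)
    (fun i hi hi' => k3 i (by omega) (by omega))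
    (fun hr => by have := hr (e + 1) (by omega) (by omega); omega) with h | ⟨s, s1, s2, s3, s4⟩
  · exact h.mono he1 (by omega)
  have es := s3 k s2 le_rfl
  have hs := hb s (by omega) (by omega)
  have hse : f s ≤ f e := by
    rcases (show e + 1 ≤ s by omega).lt_or_eq with hlt | rfl
    · have := s4 (e + 1) (by omega) hlt
      omega
    · omega
  have ep := re (l + (f s - f l)) (by omega) (by omega)
  refine (SeqHex2.hasEmptyPolygon ihA ih2 hf (p := l) (p' := l + (f s - f l)) (r := s) (r' := k)
    (q := q) (q' := q + (f k - f l)) (by omega)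
    ⟨by omega, by omega, s2, by omega, by omega, re.sub le_rfl (by omega), s3,
      rq.sub le_rfl (by omega), e1.symm, by omega, by omega, by omega, ?_, ?_⟩).mono
      le_rfl (by omega)
  · intro i hi hi'
    by_cases hie : i ≤ e
    · have := re i (by omega) hie
      omega
    · exact s4 i (by omega) hi'
  · intro i hi hi'
    have := hafter i hi hi'
    omega

theorem recurrenceBelow_and_hex2Below (n : ℕ) : RecurrenceBelow n ∧ Hex2Below n := by
  induction n with
  | zero =>
    refine ⟨fun f l q u _ hn h1 h2 => ?_, fun f p p' r r' q q' _ hn h => ?_⟩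
    · push_cast at hn
      omega
    · have := h.le_left
      have := h.lt_left
      have := h.le_mid
      have := h.lt_right
      have := h.le_right
      push_cast at hn
      omega
  | succ n ih =>
    refine ⟨fun f l q u hf hn h1 h2 h3 h4 h5 => ?_, fun f p p' r r' q q' hf hn h => ?_⟩
    · exact recurrence_hasEmptyPolygon ih.1 ih.2 hf (by push_cast at hn; omega) h1 h2 h3 h4 h5
    · exact h.hasEmptyPolygon ih.1 ih.2 hf (by push_cast at hn; omega)

theorem recurrenceBelow (n : ℤ) : RecurrenceBelow n := by
  intro f l q u hf hn
  exact (recurrenceBelow_and_hex2Below n.toNat).1 f l q u hf (by omega)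

theorem hex2Below (n : ℤ) : Hex2Below n := by
  intro f p p' r r' q q' hf hn
  exact (recurrenceBelow_and_hex2Below n.toNat).2 f p p' r r' q q' hf (by omega)

theorem lt_of_avoid {f : ℤ → ℤ} (hf : ∀ i, f (i + 1) ≤ f i + 1) {a c : ℤ}
    (h : f (a + 1) ≠ f a + 1) (hav : ∀ i, a < i → i < c → f i ≠ f a) :
    ∀ i, a < i → i < c → f i < f a := by
  intro i hi
  induction i, (show a + 1 ≤ i from hi) using Int.leInduction with
  | base =>
    intro hc
    have := hf a
    have := hav (a + 1) (by omega) hc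
    omega
  | succ j hj ih =>
    intro hc
    have := ih (by omega) (by omega)
    have := hf j
    have := hav (j + 1) (by omega) hc
    omega

theorem gt_of_avoid {f : ℤ → ℤ} (hf : ∀ i, f (i + 1) ≤ f i + 1) {a c : ℤ}
    (h : f c ≠ f (c - 1) + 1) (hav : ∀ i, a < i → i < c → f i ≠ f c) :
    ∀ i, a < i → i < c → f c < f i := by
  intro i hi hi'
  have := lt_of_avoid (halfTurn_step hf) (a := -c) (c := -a) ?_ (fun i hi hi' => ?_) (-i)
    (by omega) (by omega)
  · simp only [halfTurn, neg_neg] at this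
    omega
  · simp only [halfTurn, neg_neg]
    rw [show -(-c + 1) = c - 1 by ring]
    omega
  · have := hav (-i) (by omega) (by omega)
    simp only [halfTurn, neg_neg]
    omega

/-- The heights of the dots of `G(σ)` as a function on all columns, constant to the left of the
first dot and zero to the right of the last one. -/
def heights (σ : List ℕ) (i : ℤ) : ℤ :=
  if i < 1 then (σ.getD 0 0 : ℤ) else (σ.getD (i - 1).toNat 0 : ℤ)

theorem isDot_iff {σ : List ℕ} {i j : ℤ} :
    IsDot σ i j ↔ 1 ≤ i ∧ i ≤ σ.length ∧ j = heights σ i := by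
  constructor
  · rintro ⟨⟨k, hk⟩, rfl, rfl⟩
    have h : ¬ ((k : ℤ) + 1 < 1) := by omega
    refine ⟨by simp, by simp; omega, ?_⟩
    simp [heights, h, hk]
  · rintro ⟨h1, h2, rfl⟩
    have h : ¬ (i < 1) := by omega
    have hk : (i - 1).toNat < σ.length := by omega
    refine ⟨⟨(i - 1).toNat, hk⟩, by simp; omega, ?_⟩
    simp only [heights, if_neg h, List.getD_eq_getElem _ _ hk, List.get_eq_getElem]

theorem heights_step {σ : List ℕ} (hσ : Sawtooth σ) (i : ℤ) :
    heights σ (i + 1) ≤ heights σ i + 1 := by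
  simp only [heights]
  split_ifs with h1 h2 h2
  · omega
  · omega
  · rw [show i + 1 - 1 = 0 by omega]
    simp
  · rw [show (i + 1 - 1).toNat = (i - 1).toNat + 1 by omega]
    by_cases hl : (i - 1).toNat + 1 < σ.length
    · have := hσ _ hl
      omega
    · rw [List.getD_eq_default _ _ (by omega)]
      push_cast
      omega

theorem isDot_heights {σ : List ℕ} {i : ℤ} (h1 : 1 ≤ i) (h2 : i ≤ σ.length) :
    IsDot σ i (heights σ i) :=
  isDot_iff.2 ⟨h1, h2, rfl⟩

theorem heights_ne {σ : List ℕ} {i j : ℤ} (h1 : 1 ≤ i) (h2 : i ≤ σ.length)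
    (h : ¬ IsDot σ i j) : heights σ i ≠ j :=
  fun he => h (he ▸ isDot_heights h1 h2)

theorem OnAsc.dot {σ : List ℕ} {a y t : ℤ} (h : OnAsc σ a y t) {s : ℤ} (h0 : 0 ≤ s)
    (hs : s ≤ t) : 1 ≤ a + s ∧ a + s ≤ σ.length ∧ y + s = heights σ (a + s) :=
  isDot_iff.1 (h s h0 hs)

theorem OnAsc.first {σ : List ℕ} {a y t : ℤ} (h : OnAsc σ a y t) (ht : 0 ≤ t) :
    1 ≤ a ∧ heights σ a = y := by
  have := h.dot le_rfl ht
  simp only [add_zero] at this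
  exact ⟨this.1, this.2.2.symm⟩

theorem OnAsc.last {σ : List ℕ} {a y t : ℤ} (h : OnAsc σ a y t) (ht : 0 ≤ t) :
    a + t ≤ σ.length ∧ heights σ (a + t) = y + t := by
  have := h.dot ht le_rfl
  exact ⟨this.2.1, this.2.2.symm⟩

theorem OnAsc.isRun {σ : List ℕ} {a y t : ℤ} (h : OnAsc σ a y t) (ht : 0 ≤ t) :
    IsRun (heights σ) a (a + t) := by
  intro i hi hi'
  have h1 := (h.first ht).2
  have h2 := h.dot (s := i - a) (by omega) (by omega)
  rw [add_sub_cancel] at h2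
  omega

theorem IsRun.onAsc {σ : List ℕ} {a b t : ℤ} (h : IsRun (heights σ) a b) (ha : 1 ≤ a)
    (hb : b ≤ σ.length) (ht : a + t ≤ b) : OnAsc σ a (heights σ a) t := by
  intro s hs hs'
  have := h (a + s) (by omega) (by omega)
  exact isDot_iff.2 ⟨by omega, by omega, by omega⟩

theorem IsBox.seqBox {σ : List ℕ} (hσ : Sawtooth σ) {a b y t : ℤ} (h : IsBox σ a b y t)
    (hu : BoxUnpierced σ a b y t) : SeqBox (heights σ) a (a + t) b (b + t) := by
  have hf := heights_step hσ
  obtain ⟨h1, h2, h3, h4, h5, h6⟩ := h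
  obtain ⟨u1, u2⟩ := hu
  have ⟨a1, ea⟩ := h3.first h1
  have ⟨_, ea'⟩ := h3.last h1
  have ⟨_, eb⟩ := h5.first h1
  have ⟨bn, eb'⟩ := h5.last h1
  have n1 := heights_ne (by omega) (by omega) h4
  have n2 := heights_ne (by omega) (by omega) h6
  have up := lt_of_avoid hf (a := a + t) (c := b) (by omega) fun i hi hi' => by
    have := heights_ne (by omega) (by omega) (u2 i (by omega) (by omega))
    omega
  have lo := gt_of_avoid hf (a := a + t) (c := b) (by omega) fun i hi hi' => by
    have := heights_ne (by omega) (by omega) (u1 i (by omega) (by omega))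
    omega
  refine ⟨by omega, h2, by omega, h3.isRun h1, h5.isRun h1, by omega, by omega,
    fun i hi hi' => ?_⟩
  have := up i hi hi'
  have := lo i hi hi'
  omega

theorem IsHex1.seqHex1 {σ : List ℕ} (hσ : Sawtooth σ) {a b c y L M : ℤ}
    (h : IsHex1 σ a b c y L M) (hu : Hex1Unpierced σ a b c y L M) :
    SeqHex1 (heights σ) a (a + L) b (b + M) c (c + (L - M)) := by
  have hf := heights_step hσ
  obtain ⟨h1, h2, h3, h4, ha, ha', hb, hb', hb'', hc⟩ := h
  obtain ⟨u1, u2, u3⟩ := hu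
  have ⟨a1, ea⟩ := ha.first (by omega)
  have ⟨_, ea'⟩ := ha.last (by omega)
  have ⟨_, eb⟩ := hb.first (by omega)
  have ⟨_, eb'⟩ := hb.last (by omega)
  have ⟨_, ec⟩ := hc.first (by omega)
  have ⟨cn, ec'⟩ := hc.last (by omega)
  have ra := ha.isRun (by omega)
  have hab : a + L < b := by
    by_contra hlt
    have := ra b (by omega) (by omega)
    omega
  have hML : M < L := by
    by_contra hlt
    exact heights_ne (by omega) (by omega) (u3 (b + M) (by omega) (by omega)) (by omega)
  have n1 := heights_ne (by omega) (by omega) ha'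
  have n2 := heights_ne (by omega) (by omega) hb'
  have n3 := heights_ne (by omega) (by omega) hb''
  have up := lt_of_avoid hf (a := a + L) (c := b) (by omega) fun i hi hi' => by
    have := heights_ne (by omega) (by omega) (u3 i (by omega) (by omega))
    omega
  have lo := gt_of_avoid hf (a := a + L) (c := b) (by omega) fun i hi hi' => by
    have := heights_ne (by omega) (by omega) (u1 i (by omega) (by omega))
    omega
  have up' := lt_of_avoid hf (a := b + M) (c := c) (by omega) fun i hi hi' => by
    have := heights_ne (by omega) (by omega) (u2 i (by omega) (by omega))
    omega
  refine ⟨by omega, hab, by omega, h4, by omega, ra, hb.isRun (by omega), hc.isRun (by omega),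
    by omega, by omega, by omega, by omega, fun i hi hi' => ?_, up'⟩
  have := up i hi hi'
  have := lo i hi hi'
  omega

theorem IsHex2.seqHex2 {σ : List ℕ} (hσ : Sawtooth σ) {p q r y L M : ℤ}
    (h : IsHex2 σ p q r y L M) (hu : Hex2Unpierced σ p q r y L M) :
    SeqHex2 (heights σ) p (p + (L - M)) r (r + M) q (q + L) := by
  have hf := heights_step hσ
  obtain ⟨h1, h2, h3, h4, h5, hp, hr, hr', hr'', hq, hq'⟩ := h
  obtain ⟨u1, u2, u3⟩ := hu
  have ⟨p1, ep⟩ := hp.first (by omega)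
  have ⟨_, ep'⟩ := hp.last (by omega)
  have ⟨_, er⟩ := hr.first (by omega)
  have ⟨_, er'⟩ := hr.last (by omega)
  have ⟨_, eq⟩ := hq.first (by omega)
  have ⟨qn, eq'⟩ := hq.last (by omega)
  have rq := hq.isRun (by omega)
  have hrq : r + M < q := by
    by_contra hlt
    have := rq (r + M) (by omega) (by omega)
    omega
  have hML : M < L := by
    by_contra hlt
    exact heights_ne (by omega) (by omega) (u1 r (by omega) (by omega)) (by omega)
  have n1 := heights_ne (by omega) (by omega) hr'
  have n2 := heights_ne (by omega) (by omega) hr''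
  have n3 := heights_ne (by omega) (by omega) hq'
  have up := lt_of_avoid hf (a := r + M) (c := q) (by omega) fun i hi hi' => by
    have := heights_ne (by omega) (by omega) (u3 i (by omega) (by omega))
    omega
  have lo := gt_of_avoid hf (a := r + M) (c := q) (by omega) fun i hi hi' => by
    have := heights_ne (by omega) (by omega) (u1 i (by omega) (by omega))
    omega
  have lo' := gt_of_avoid hf (a := p + (L - M)) (c := r) (by omega) fun i hi hi' => by
    have := heights_ne (by omega) (by omega) (u2 i (by omega) (by omega))
    omega
  refine ⟨by omega, h4, by omega, hrq, by omega, hp.isRun (by omega), hr.isRun (by omega), rq,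
    by omega, by omega, by omega, by omega, lo', fun i hi hi' => ?_⟩
  have := up i hi hi'
  have := lo i hi hi'
  omega

theorem SeqBox.exists_dgPoly {σ : List ℕ} {a a' b' : ℤ} (ha : 1 ≤ a) (hb : b' ≤ σ.length)
    (h : SeqBox (heights σ) a a' (a' + 1) b') :
    ∃ P : DGPoly, P.Valid σ ∧ P.Unpierced σ ∧ P.IsEmpty σ := by
  obtain ⟨h1, h2, h3, ra, rb, e1, e2, -⟩ := h
  have ea := ra a' h1 le_rfl
  have eb := rb b' h3 le_rfl
  refine ⟨.box a (a' + 1) (heights σ a) (a' - a), ⟨by omega, by omega,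
    ra.onAsc ha (by omega) (by omega), ?_, e1 ▸ rb.onAsc (by omega) hb (by omega), ?_⟩,
    ⟨fun i hi hi' hd => ?_, fun i hi hi' hd => ?_⟩, fun i h hh1 hh2 hi hi' hd => ?_⟩
  · rw [isDot_iff, show a + (a' - a) + 1 = a' + 1 by ring]
    omega
  · rw [isDot_iff, show a' + 1 - 1 = a' by ring]
    omega
  · have := isDot_iff.1 hd
    have := ra i (by omega) (by omega)
    omega
  · have := isDot_iff.1 hd
    have := rb i (by omega) (by omega)
    omega
  · have := isDot_iff.1 hd
    by_cases hia : i ≤ a'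
    · have := ra i (by omega) (by omega)
      omega
    · have := rb i (by omega) (by omega)
      omega

theorem SeqHex1.exists_dgPoly {σ : List ℕ} {a a' b' c c' : ℤ} (ha : 1 ≤ a)
    (hc : c' ≤ σ.length) (h : SeqHex1 (heights σ) a a' (a' + 1) b' c c') :
    ∃ P : DGPoly, P.Valid σ ∧ P.Unpierced σ ∧ P.IsEmpty σ := by
  obtain ⟨h1, h2, h3, h4, h5, ra, rb, rc, e1, e2, e3, hl, -, hb⟩ := h
  have ea := ra a' h1 le_rfl
  have eb := rb b' h3 le_rfl
  have ec := rc c' h5 le_rfl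
  have hrc := rc.onAsc (t := c' - c) (by omega) hc (by omega)
  refine ⟨.hex1 a (a' + 1) c (heights σ a) (a' - a) (b' - (a' + 1)), ⟨by omega, by omega,
    by omega, by omega, ra.onAsc ha (by omega) (by omega), ?_,
    e1 ▸ rb.onAsc (by omega) (by omega) (by omega), ?_, ?_, ?_⟩,
    ⟨fun i hi hi' hd => ?_, fun i hi hi' hd => ?_, fun i hi hi' hd => ?_⟩, ?_⟩
  · rw [isDot_iff, show a + (a' - a) + 1 = a' + 1 by ring]
    omega
  · rw [isDot_iff, show a' + 1 - 1 = a' by ring]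
    omega
  · rw [isDot_iff, show a' + 1 + (b' - (a' + 1)) + 1 = b' + 1 by ring]
    rcases (show b' + 1 ≤ c by omega).lt_or_eq with hlt | heq
    · have := hb (b' + 1) (by omega) hlt
      omega
    · rw [heq]
      omega
  · convert hrc using 1 <;> omega
  · have := isDot_iff.1 hd
    have := ra i (by omega) (by omega)
    omega
  · have := isDot_iff.1 hd
    have := hb i (by omega) (by omega)
    omega
  · have := isDot_iff.1 hd
    by_cases hib : i ≤ b'
    · have := rb i (by omega) (by omega)
      omega
    by_cases hic : i < c
    · have := hb i (by omega) hic
      omega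
    · have := rc i (by omega) (by omega)
      omega
  · rintro ⟨i, h⟩ ⟨g1, g2, g3, g4, g5⟩ hd
    dsimp only at g1 g2 g3 g4 g5 hd
    have := isDot_iff.1 hd
    by_cases hia : i ≤ a'
    · have := ra i (by omega) (by omega)
      omega
    by_cases hib : i ≤ b'
    · have := rb i (by omega) (by omega)
      omega
    by_cases hic : i < c
    · have := hb i (by omega) hic
      omega
    · have := rc i (by omega) (by omega)
      omega

theorem SeqHex2.exists_dgPoly {σ : List ℕ} {p p' r r' q' : ℤ} (hp : 1 ≤ p)
    (hq : q' ≤ σ.length) (h : SeqHex2 (heights σ) p p' r r' (r' + 1) q') :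
    ∃ P : DGPoly, P.Valid σ ∧ P.Unpierced σ ∧ P.IsEmpty σ := by
  obtain ⟨h1, h2, h3, h4, h5, rp, rr, rq, e1, e2, e3, hl, hb, -⟩ := h
  have ep := rp p' h1 le_rfl
  have er := rr r' h3 le_rfl
  have eq := rq q' h5 le_rfl
  have hrr := rr.onAsc (t := r' - r) (by omega) (by omega) (by omega)
  refine ⟨.hex2 p (r' + 1) r (heights σ p) (q' - (r' + 1)) (r' - r), ⟨by omega, by omega,
    by omega, by omega, by omega, rp.onAsc hp (by omega) (by omega), ?_, ?_, ?_,
    e1 ▸ rq.onAsc (by omega) (by omega) (by omega), ?_⟩,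
    ⟨fun i hi hi' hd => ?_, fun i hi hi' hd => ?_, fun i hi hi' hd => ?_⟩, ?_⟩
  · convert hrr using 1
    omega
  · rw [isDot_iff]
    rcases (show p' ≤ r - 1 by omega).lt_or_eq with hlt | heq
    · have := hb (r - 1) hlt (by omega)
      omega
    · rw [← heq]
      omega
  · rw [isDot_iff, show r + (r' - r) + 1 = r' + 1 by ring]
    omega
  · rw [isDot_iff, show r' + 1 - 1 = r' by ring]
    omega
  · have := isDot_iff.1 hd
    by_cases hip : i ≤ p'
    · have := rp i (by omega) (by omega)
      omega
    by_cases hir : i < r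
    · have := hb i (by omega) hir
      omega
    · have := rr i (by omega) (by omega)
      omega
  · have := isDot_iff.1 hd
    have := hb i (by omega) (by omega)
    omega
  · have := isDot_iff.1 hd
    have := rq i (by omega) (by omega)
    omega
  · rintro ⟨i, h⟩ ⟨g1, g2, g3, g4, g5⟩ hd
    dsimp only at g1 g2 g3 g4 g5 hd
    have := isDot_iff.1 hd
    by_cases hip : i ≤ p'
    · have := rp i (by omega) (by omega)
      omega
    by_cases hir : i < r
    · have := hb i (by omega) hir
      omega
    by_cases hir' : i ≤ r'
    · have := rr i (by omega) (by omega)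
      omega
    · have := rq i (by omega) (by omega)
      omega

theorem HasEmptyPolygon.exists_dgPoly {σ : List ℕ} {l u : ℤ}
    (h : HasEmptyPolygon (heights σ) l u) (hl : 1 ≤ l) (hu : u ≤ σ.length) :
    ∃ P : DGPoly, P.Valid σ ∧ P.Unpierced σ ∧ P.IsEmpty σ := by
  rcases h with ⟨a, a', b', h1, h2, h⟩ | ⟨a, a', b', c, c', h1, h2, h⟩ |
    ⟨p, p', r, r', q', h1, h2, h⟩
  · exact h.exists_dgPoly (by omega) (by omega)
  · exact h.exists_dgPoly (by omega) (by omega)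
  · exact h.exists_dgPoly (by omega) (by omega)

/-- If `G(σ)` contains an unpierced box or an unpierced hexagon of
type 1 or 2, then it contains an empty unpierced box or an empty unpierced hexagon of
type 1 or 2. -/
theorem exists_empty_unpierced (σ : List ℕ) (hsaw : Sawtooth σ)
    (h : ∃ P : DGPoly, P.Valid σ ∧ P.Unpierced σ) :
    ∃ P : DGPoly, P.Valid σ ∧ P.Unpierced σ ∧ P.IsEmpty σ := by
  obtain ⟨P, hv, hu⟩ := h
  have hf := heights_step hsaw
  cases P with
  | box a b y t =>
    have hs := IsBox.seqBox hsaw hv hu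
    have ha := (hv.2.2.1.first hv.1).1
    have hb := (hv.2.2.2.2.1.last hv.1).1
    exact (hs.hasEmptyPolygon (recurrenceBelow _) (hex2Below _).hex1Below hf
      le_rfl).exists_dgPoly ha hb
  | hex1 a b c y L M =>
    have hs := IsHex1.seqHex1 hsaw hv hu
    obtain ⟨h1, h2, -, -, ha, -, -, -, -, hc⟩ := hv
    exact ((hex2Below _).hex1Below _ _ _ _ _ _ _ hf (Int.lt_succ _) hs).exists_dgPoly
      (ha.first (by omega)).1 (hc.last (by omega)).1
  | hex2 p q r y L M =>
    have hs := IsHex2.seqHex2 hsaw hv hu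
    obtain ⟨h1, h2, -, -, -, hp, -, -, -, hq, -⟩ := hv
    exact (hex2Below _ _ _ _ _ _ _ _ hf (Int.lt_succ _) hs).exists_dgPoly
      (hp.first (by omega)).1 (hq.last (by omega)).1
end

section
/- Let n ≥ 2 and let σ be any finite sequence with all entries in {1, …, n−1} such that more than n−1 entries of σ are equal to 1. Then there exists a finite sequence of commutations transforming σ into a sequence τ that is in sawtooth form and whose dot graph G(τ) contains an empty unpierced box or an empty unpierced hexagon of type 1 or type 2. -/
theorem Commutation.cons {l l' : List ℕ} (a : ℕ) (h : Commutation l l') :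
    Commutation (a :: l) (a :: l') := by
  obtain ⟨u, r, x, y, hxy, rfl, rfl⟩ := h
  exact ⟨a :: u, r, x, y, hxy, rfl, rfl⟩

theorem Commutation.perm {l l' : List ℕ} (h : Commutation l l') : l.Perm l' := by
  obtain ⟨u, r, x, y, -, rfl, rfl⟩ := h
  exact (List.Perm.swap y x r).append_left u

theorem perm_of_reflTransGen_commutation {l l' : List ℕ}
    (h : Relation.ReflTransGen Commutation l l') : l.Perm l' := by
  induction h with
  | refl => exact .refl _
  | tail _ h ih => exact ih.trans h.perm

theorem reflTransGen_commutation_cons {l l' : List ℕ} (a : ℕ)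
    (h : Relation.ReflTransGen Commutation l l') :
    Relation.ReflTransGen Commutation (a :: l) (a :: l') :=
  h.lift (a :: ·) fun _ _ => Commutation.cons a

theorem sawtooth_iff_isChain (l : List ℕ) :
    Sawtooth l ↔ l.IsChain (fun a b => b ≤ a + 1) := by
  rw [List.isChain_iff_getElem]
  constructor
  · intro h i hi
    have := h i hi
    rw [List.getD_eq_getElem _ _ hi, List.getD_eq_getElem _ _ (Nat.lt_of_succ_lt hi)] at this
    omega
  · intro h i hi
    have := h i hi
    rw [List.getD_eq_getElem _ _ hi, List.getD_eq_getElem _ _ (Nat.lt_of_succ_lt hi)]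
    omega

/-- Inserting a letter in front of a chain by commutations; the first letter of the result is
the inserted letter or the first letter of the chain. -/
theorem exists_isChain_insert (x : ℕ) (l : List ℕ) (hl : l.IsChain (fun a b => b ≤ a + 1)) :
    ∃ l' : List ℕ, Relation.ReflTransGen Commutation (x :: l) l' ∧
      l'.IsChain (fun a b => b ≤ a + 1) ∧
      ∀ z ∈ l'.head?, z = x ∨ z ∈ l.head? := by
  induction l with
  | nil => exact ⟨[x], .refl, by simp, by simp⟩
  | cons y l ih =>
    by_cases hxy : y ≤ x + 1
    · exact ⟨x :: y :: l, .refl, by simpa using ⟨hxy, hl⟩, by simp⟩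
    · rw [List.isChain_cons] at hl
      obtain ⟨l', h₁, h₂, h₃⟩ := ih hl.2
      refine ⟨y :: l', .head ⟨[], l, x, y, by omega, rfl, rfl⟩
        (reflTransGen_commutation_cons y h₁), ?_, by simp⟩
      rw [List.isChain_cons]
      refine ⟨fun z hz => ?_, h₂⟩
      rcases h₃ z hz with rfl | hz
      · omega
      · exact hl.1 z hz

theorem exists_sawtooth (l : List ℕ) :
    ∃ l' : List ℕ, Relation.ReflTransGen Commutation l l' ∧ Sawtooth l' := by
  induction l with
  | nil => exact ⟨[], .refl, by simp [Sawtooth]⟩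
  | cons x l ih =>
    obtain ⟨l₁, h₁, h₂⟩ := ih
    obtain ⟨l₂, h₃, h₄, -⟩ := exists_isChain_insert x l₁ ((sawtooth_iff_isChain l₁).1 h₂)
    exact ⟨l₂, (reflTransGen_commutation_cons x h₁).trans h₃, (sawtooth_iff_isChain l₂).2 h₄⟩

/-- The decomposition of a dot graph into `m` ascending segments, listed from left to right:
the `k`-th one occupies the heights from `s k` to `e k` on the line `i - j = q k`. -/
structure Segmentation (τ : List ℕ) (m : ℕ) (s e q : ℕ → ℤ) : Prop where
  le : ∀ k < m, s k ≤ e k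
  step : ∀ k, k + 1 < m → s (k + 1) ≤ e k
  q_succ : ∀ k, k + 1 < m → q (k + 1) + s (k + 1) = q k + e k + 1
  dot_iff : ∀ i j, IsDot τ i j ↔ ∃ k < m, i - j = q k ∧ s k ≤ j ∧ j ≤ e k

theorem isDot_append_singleton (τ : List ℕ) (x : ℕ) (i j : ℤ) :
    IsDot (τ ++ [x]) i j ↔ IsDot τ i j ∨ (i = τ.length + 1 ∧ j = x) := by
  constructor
  · rintro ⟨⟨k, hk⟩, rfl, rfl⟩
    rw [List.length_append, List.length_singleton] at hk
    rcases Nat.lt_succ_iff_lt_or_eq.1 hk with h | rfl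
    · exact .inl ⟨⟨k, h⟩, rfl, by simp [List.getElem_append_left h]⟩
    · exact .inr ⟨rfl, by simp⟩
  · rintro (⟨⟨k, hk⟩, rfl, rfl⟩ | ⟨rfl, rfl⟩)
    · exact ⟨⟨k, by simp; omega⟩, rfl, by simp [List.getElem_append_left hk]⟩
    · exact ⟨⟨τ.length, by simp⟩, rfl, by simp⟩

theorem exists_segmentation (τ : List ℕ) (h : τ.IsChain (fun a b => b ≤ a + 1)) :
    ∃ m s e q, Segmentation τ m s e q ∧
      ∀ x ∈ τ.getLast?, 0 < m ∧ e (m - 1) = x ∧ q (m - 1) + x = τ.length := by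
  induction τ using List.reverseRecOn with
  | nil =>
    refine ⟨0, 0, 0, 0, ⟨by simp, by simp, by simp, fun i j => ?_⟩, by simp⟩
    simp [IsDot]
  | append_singleton τ x ih =>
    rw [List.isChain_append] at h
    obtain ⟨m, s, e, q, hseg, hlast⟩ := ih h.1
    rcases hτ : τ.getLast? with _ | y
    · obtain rfl : τ = [] := by simpa using hτ
      refine ⟨1, fun _ => x, fun _ => x, fun _ => 1 - x,
        ⟨by simp, by simp, by simp, fun i j => ?_⟩, by simp⟩
      rw [isDot_append_singleton]
      simp only [List.length_nil, Nat.cast_zero, zero_add, Nat.lt_one_iff, exists_eq_left]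
      constructor
      · rintro (⟨⟨_, hk⟩, -⟩ | h)
        · simp at hk
        · omega
      · intro h
        right
        omega
    · obtain ⟨hm, he, hq⟩ := hlast y hτ
      have hxy : x ≤ y + 1 := h.2.2 y hτ x (by simp)
      obtain ⟨m, rfl⟩ : ∃ m', m = m' + 1 := ⟨m - 1, by omega⟩
      simp only [Nat.add_sub_cancel] at he hq
      by_cases hxy' : x = y + 1
      · refine ⟨m + 1, s, Function.update e m x, q, ⟨?_, ?_, ?_, fun i j => ?_⟩, ?_⟩
        · intro k hk
          have := hseg.le k hk
          rcases eq_or_ne k m with rfl | hkm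
          · simp only [Function.update_self]; omega
          · rwa [Function.update_of_ne hkm]
        · intro k hk
          rw [Function.update_of_ne (by omega)]
          exact hseg.step k hk
        · intro k hk
          rw [Function.update_of_ne (by omega)]
          exact hseg.q_succ k hk
        · rw [isDot_append_singleton, hseg.dot_iff]
          constructor
          · rintro (⟨k, hk, h₁, h₂, h₃⟩ | ⟨rfl, rfl⟩)
            · refine ⟨k, hk, h₁, h₂, ?_⟩
              rcases eq_or_ne k m with rfl | hkm
              · simp only [Function.update_self]; omega
              · rwa [Function.update_of_ne hkm]
            · have := hseg.le m (by omega)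
              refine ⟨m, by omega, by omega, by omega, by simp⟩
          · rintro ⟨k, hk, h₁, h₂, h₃⟩
            rcases eq_or_ne k m with rfl | hkm
            · simp only [Function.update_self] at h₃
              by_cases hj : j ≤ y
              · exact .inl ⟨k, hk, h₁, h₂, by omega⟩
              · right; omega
            · rw [Function.update_of_ne hkm] at h₃
              exact .inl ⟨k, hk, h₁, h₂, h₃⟩
        · simp
          omega
      · refine ⟨m + 2, Function.update s (m + 1) x, Function.update e (m + 1) x,
          Function.update q (m + 1) (τ.length + 1 - x), ⟨?_, ?_, ?_, fun i j => ?_⟩, by simp⟩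
        · intro k hk
          rcases eq_or_ne k (m + 1) with rfl | hkm
          · simp
          · simpa only [Function.update_of_ne hkm] using hseg.le k (by omega)
        · intro k hk
          rcases eq_or_ne k m with rfl | hkm
          · simp; omega
          · simpa [Function.update_apply, show k ≠ m + 1 by omega, hkm] using
              hseg.step k (by omega)
        · intro k hk
          rcases eq_or_ne k m with rfl | hkm
          · simp; omega
          · simpa [Function.update_apply, show k ≠ m + 1 by omega, hkm] using
              hseg.q_succ k (by omega)
        · rw [isDot_append_singleton, hseg.dot_iff]
          constructor
          · rintro (⟨k, hk, h⟩ | ⟨rfl, rfl⟩)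
            · exact ⟨k, by omega, by simpa only [Function.update_of_ne hk.ne] using h⟩
            · exact ⟨m + 1, by omega, by simp⟩
          · rintro ⟨k, hk, h⟩
            rcases eq_or_ne k (m + 1) with rfl | hkm
            · simp only [Function.update_self] at h
              right; omega
            · simp only [Function.update_of_ne hkm] at h
              exact .inl ⟨k, by omega, h⟩

/-- The dot graph contains an empty unpierced polygon. -/
def HasEmptyUnpierced (τ : List ℕ) : Prop :=
  ∃ P : DGPoly, P.Valid τ ∧ P.Unpierced τ ∧ P.IsEmpty τ

namespace Segmentation

variable {τ : List ℕ} {m : ℕ} {s e q : ℕ → ℤ}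

theorem q_lt (hS : Segmentation τ m s e q) {k l : ℕ} (hkl : k < l) (hl : l < m) : q k < q l := by
  induction l, hkl using Nat.le_induction with
  | base =>
    have := hS.step k hl
    have := hS.q_succ k hl
    rw [Nat.succ_eq_add_one]
    omega
  | succ l hkl ih =>
    have := hS.step l hl
    have := hS.q_succ l hl
    have := ih (by omega)
    omega

theorem lt_of_q_lt (hS : Segmentation τ m s e q) {k l : ℕ} (hk : k < m) (h : q k < q l) :
    k < l := by
  by_contra! hlk
  rcases hlk.eq_or_lt with rfl | hlk
  · exact h.false
  · exact (hS.q_lt hlk hk).not_gt h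

theorem isDot_of_col (hS : Segmentation τ m s e q) {k : ℕ} (hk : k < m) {i j : ℤ}
    (hij : i - j = q k) (h₁ : s k ≤ j) (h₂ : j ≤ e k) : IsDot τ i j :=
  (hS.dot_iff i j).2 ⟨k, hk, hij, h₁, h₂⟩

theorem mem_of_isDot (hS : Segmentation τ m s e q) {k : ℕ} (hk : k < m) {i j : ℤ}
    (h : IsDot τ i j) (hij : i - j = q k) : s k ≤ j ∧ j ≤ e k := by
  obtain ⟨l, hl, h₁, h₂⟩ := (hS.dot_iff i j).1 h
  have h₃ := fun h => (hS.q_lt (k := k) (l := l) h hl).ne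
  have h₄ := fun h => (hS.q_lt (k := l) (l := k) h hk).ne
  obtain rfl : k = l := by
    rcases lt_trichotomy k l with h | h | h
    · have := h₃ h; omega
    · exact h
    · have := h₄ h; omega
  exact h₂

theorem exists_between (hS : Segmentation τ m s e q) {k l : ℕ} (hk : k < m) {i j : ℤ}
    (h : IsDot τ i j) (h₁ : q k < i - j) (h₂ : i - j < q l) :
    ∃ c, k < c ∧ c < l ∧ s c ≤ j ∧ j ≤ e c := by
  obtain ⟨c, hc, h₃, h₄⟩ := (hS.dot_iff i j).1 h
  rw [h₃] at h₁ h₂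
  exact ⟨c, hS.lt_of_q_lt hk h₁, hS.lt_of_q_lt hc h₂, h₄⟩

theorem hasEmptyUnpierced_box (hS : Segmentation τ m s e q) {k : ℕ} (hk : k + 1 < m)
    (hs : s k ≤ s (k + 1)) (he : e k ≤ e (k + 1)) : HasEmptyUnpierced τ := by
  have h₁ := hS.step k hk
  have h₂ := hS.q_succ k hk
  refine ⟨.box (q k + s (k + 1)) (q (k + 1) + s (k + 1)) (s (k + 1)) (e k - s (k + 1)),
    ⟨by omega, by omega, fun z _ _ => ?_, fun h => ?_, fun z _ _ => ?_, fun h => ?_⟩,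
    ⟨fun i _ _ h => ?_, fun i _ _ h => ?_⟩, fun i j _ _ _ _ h => ?_⟩
  · exact hS.isDot_of_col (k := k) (by omega) (by omega) (by omega) (by omega)
  · have := hS.mem_of_isDot (k := k) (by omega) h (by omega); omega
  · exact hS.isDot_of_col hk (by omega) (by omega) (by omega)
  · have := hS.mem_of_isDot hk h (by omega); omega
  all_goals
    obtain ⟨c, _, _, _⟩ :=
      hS.exists_between (k := k) (l := k + 1) (by omega) h (by omega) (by omega)
    omega

theorem hasEmptyUnpierced_hex1 (hS : Segmentation τ m s e q) {a c : ℕ} (hac : a + 1 < c)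
    (hc : c < m) (hs : s a ≤ s (a + 1)) (he : e (a + 1) < e a)
    (hbetween : ∀ i, a + 1 < i → i < c → e i < e (a + 1)) (hec : e a ≤ e c) :
    HasEmptyUnpierced τ := by
  have h₁ := hS.le (a + 1) (by omega)
  have hab := hS.q_lt (k := a) (l := a + 1) (by omega) (by omega)
  have hbc := hS.q_lt hac hc
  have hsc : s c ≤ e (a + 1) := by
    obtain ⟨d, rfl⟩ : ∃ d, c = d + 1 := ⟨c - 1, by omega⟩
    have := hS.step d hc
    rcases (show a + 1 = d ∨ a + 1 < d by omega) with rfl | h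
    · exact this
    · have := hbetween d h (by omega); omega
  refine ⟨.hex1 (q a + s (a + 1)) (q (a + 1) + s (a + 1)) (q c + e (a + 1)) (s (a + 1))
      (e a - s (a + 1)) (e (a + 1) - s (a + 1)),
    ⟨by omega, by omega, by omega, by omega, fun z _ _ => ?_, fun h => ?_, fun z _ _ => ?_,
      fun h => ?_, fun h => ?_, fun z _ _ => ?_⟩,
    ⟨fun i _ _ h => ?_, fun i _ _ h => ?_, fun i _ _ h => ?_⟩, ?_⟩
  · exact hS.isDot_of_col (k := a) (by omega) (by omega) (by omega) (by omega)
  · have := hS.mem_of_isDot (k := a) (by omega) h (by omega); omega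
  · exact hS.isDot_of_col (k := a + 1) (by omega) (by omega) (by omega) (by omega)
  · have := hS.mem_of_isDot (k := a + 1) (by omega) h (by omega); omega
  · have := hS.mem_of_isDot (k := a + 1) (by omega) h (by omega); omega
  · exact hS.isDot_of_col hc (by omega) (by omega) (by omega)
  · obtain ⟨d, _, _, _⟩ :=
      hS.exists_between (k := a) (l := a + 1) (by omega) h (by omega) (by omega)
    omega
  · obtain ⟨d, h₂, h₃, _⟩ :=
      hS.exists_between (k := a + 1) (l := c) (by omega) h (by omega) (by omega)
    have := hbetween d h₂ h₃
    omega
  · obtain ⟨d, h₂, h₃, h₄⟩ :=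
      hS.exists_between (k := a) (l := c) (by omega) h (by omega) (by omega)
    rcases (show d = a + 1 ∨ a + 1 < d by omega) with rfl | h₂
    · omega
    · have := hbetween d h₂ h₃
      omega
  · rintro ⟨i, j⟩ ⟨_, _, _, hb, hc'⟩ h
    simp only at *
    rcases le_or_gt j (e (a + 1)) with hj | hj
    · have := hb (by omega)
      obtain ⟨d, _, _, _⟩ :=
        hS.exists_between (k := a) (l := a + 1) (by omega) h (by omega) (by omega)
      omega
    · have := hc' (by omega)
      obtain ⟨d, h₂, h₃, h₄⟩ :=
        hS.exists_between (k := a) (l := c) (by omega) h (by omega) (by omega)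
      rcases (show d = a + 1 ∨ a + 1 < d by omega) with rfl | h₂
      · omega
      · have := hbetween d h₂ h₃
        omega

theorem hasEmptyUnpierced_hex2 (hS : Segmentation τ m s e q) {p r : ℕ} (hpr : p < r)
    (hr : r + 1 < m) (hs : s (r + 1) < s r) (he : e r ≤ e (r + 1))
    (hbetween : ∀ i, p < i → i < r → s r < s i) (hsp : s p ≤ s (r + 1)) :
    HasEmptyUnpierced τ := by
  have h₁ := hS.le r (by omega)
  have hpq := hS.q_lt hpr (by omega)
  have hqr := hS.q_lt (k := r) (l := r + 1) (by omega) hr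
  have hep : s r ≤ e p := by
    have := hS.step p (by omega)
    rcases (show p + 1 = r ∨ p + 1 < r by omega) with rfl | h
    · exact this
    · have := hbetween (p + 1) (by omega) h; omega
  refine ⟨.hex2 (q p + s (r + 1)) (q (r + 1) + s (r + 1)) (q r + s r) (s (r + 1))
      (e r - s (r + 1)) (e r - s r),
    ⟨by omega, by omega, by omega, by omega, by omega, fun z _ _ => ?_, fun z _ _ => ?_,
      fun h => ?_, fun h => ?_, fun z _ _ => ?_, fun h => ?_⟩,
    ⟨fun i _ _ h => ?_, fun i _ _ h => ?_, fun i _ _ h => ?_⟩, ?_⟩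
  · exact hS.isDot_of_col (k := p) (by omega) (by omega) (by omega) (by omega)
  · exact hS.isDot_of_col (k := r) (by omega) (by omega) (by omega) (by omega)
  · have := hS.mem_of_isDot (k := r) (by omega) h (by omega); omega
  · have := hS.mem_of_isDot (k := r) (by omega) h (by omega); omega
  · exact hS.isDot_of_col hr (by omega) (by omega) (by omega)
  · have := hS.mem_of_isDot hr h (by omega); omega
  · obtain ⟨d, h₂, h₃, h₄⟩ :=
      hS.exists_between (k := p) (l := r + 1) (by omega) h (by omega) (by omega)
    rcases (show d = r ∨ d < r by omega) with rfl | h₃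
    · omega
    · have := hbetween d h₂ h₃
      omega
  · obtain ⟨d, h₂, h₃, _⟩ :=
      hS.exists_between (k := p) (l := r) (by omega) h (by omega) (by omega)
    have := hbetween d h₂ h₃
    omega
  · obtain ⟨d, _, _, _⟩ :=
      hS.exists_between (k := r) (l := r + 1) (by omega) h (by omega) (by omega)
    omega
  · rintro ⟨i, j⟩ ⟨_, _, _, hb, hc'⟩ h
    simp only at *
    rcases le_or_gt (s r) j with hj | hj
    · have := hc' (by omega)
      obtain ⟨d, _, _, _⟩ :=
        hS.exists_between (k := r) (l := r + 1) (by omega) h (by omega) (by omega)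
      omega
    · have := hb (by omega)
      obtain ⟨d, h₂, h₃, h₄⟩ :=
        hS.exists_between (k := p) (l := r + 1) (by omega) h (by omega) (by omega)
      rcases (show d = r ∨ d < r by omega) with rfl | h₃
      · omega
      · have := hbetween d h₂ h₃
        omega

end Segmentation

theorem exists_first {P : ℕ → Prop} {a b : ℕ} (hab : a < b) (hb : P b) :
    ∃ c, a < c ∧ c ≤ b ∧ P c ∧ ∀ i, a < i → i < c → ¬ P i := by
  classical
  have h : ∃ c, a < c ∧ P c := ⟨b, hab, hb⟩
  exact ⟨Nat.find h, (Nat.find_spec h).1, Nat.find_min' h ⟨hab, hb⟩, (Nat.find_spec h).2,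
    fun i hai hi hP => Nat.find_min h hi ⟨hai, hP⟩⟩

theorem exists_last_s12 {P : ℕ → Prop} {a b : ℕ} (hab : a < b) (ha : P a) :
    ∃ c, a ≤ c ∧ c < b ∧ P c ∧ ∀ i, c < i → i < b → ¬ P i := by
  induction b, hab using Nat.le_induction with
  | base => exact ⟨a, le_rfl, by omega, ha, by omega⟩
  | succ b hab ih =>
    by_cases hb : P b
    · exact ⟨b, by omega, by omega, hb, by omega⟩
    · obtain ⟨c, h₁, h₂, h₃, h₄⟩ := ih
      refine ⟨c, h₁, by omega, h₃, fun i hi hib => ?_⟩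
      rcases (show i < b ∨ i = b by omega) with h | rfl
      · exact h₄ i hi h
      · exact hb

/-- The segments `k` and `l` bound a box that no intermediate segment crosses from
bottom to top. -/
def CoarseBox (s e : ℕ → ℤ) (k l : ℕ) : Prop :=
  s k ≤ s l ∧ e k ≤ e l ∧ ∀ i, k < i → i < l → s l < s i ∨ e i < e k

/-- The segments `a`, `b`, `b + 1` bound a hexagon of type 1, except that there may be
segments between `a` and `b`. -/
def CoarseHex1 (s e : ℕ → ℤ) (a b : ℕ) : Prop :=
  s a ≤ s b ∧ e b < e a ∧ e a ≤ e (b + 1) ∧ ∀ i, a < i → i < b → s b < s i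

/-- The segments `p`, `p + 1`, `t` bound a hexagon of type 2, except that there may be
segments between `p + 1` and `t`. -/
def CoarseHex2 (s e : ℕ → ℤ) (p t : ℕ) : Prop :=
  s p ≤ s t ∧ s t < s (p + 1) ∧ e (p + 1) ≤ e t ∧ ∀ i, p + 1 < i → i < t → e i < e (p + 1)

namespace Segmentation

variable {τ : List ℕ} {m : ℕ} {s e q : ℕ → ℤ}

/-- The step shared by coarse boxes and coarse hexagons of type 1: all segments strictly between
`a` and `l` end below the segment `a`, and `l` does not. -/
theorem hasEmptyUnpierced_of_shrink (hS : Segmentation τ m s e q) {a l : ℕ}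
    (hal : a + 1 < l) (hl : l < m)
    (hbox : ∀ k c, a < k → k < c → c < l → CoarseBox s e k c → HasEmptyUnpierced τ)
    (hhex : ∀ c, a + 1 < c → c < l → CoarseHex2 s e a c → HasEmptyUnpierced τ)
    (hs : ∀ i, a < i → i < l → s a ≤ s i) (he : ∀ i, a < i → i < l → e i < e a)
    (hle : e a ≤ e l) : HasEmptyUnpierced τ := by
  have he₁ := he (a + 1) (by omega) hal
  obtain ⟨c, hac, hcl, hc, hfirst⟩ :=
    exists_first (P := fun c => e (a + 1) ≤ e c) hal (by omega)
  simp only [not_le] at hfirst hc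
  by_cases hac' : e a ≤ e c
  · exact hS.hasEmptyUnpierced_hex1 hac (by omega) (hs _ (by omega) hal) he₁ hfirst hac'
  · have hcl' : c < l := by
      rcases hcl.eq_or_lt with rfl | h
      · exact absurd hle hac'
      · exact h
    by_cases hsc : s (a + 1) ≤ s c
    · exact hbox (a + 1) c (by omega) hac hcl' ⟨hsc, hc, fun i h h' => .inr (hfirst i h h')⟩
    · exact hhex c hac hcl' ⟨hs c (by omega) hcl', by omega, hc, hfirst⟩

theorem hasEmptyUnpierced_of_coarse (hS : Segmentation τ m s e q) (N : ℕ) :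
    (∀ k l, k < l → l < m → l - k = N → CoarseBox s e k l → HasEmptyUnpierced τ) ∧
    (∀ a b, a < b → b + 1 < m → b + 1 - a = N → CoarseHex1 s e a b → HasEmptyUnpierced τ) ∧
    (∀ p t, p + 1 < t → t < m → t - p = N → CoarseHex2 s e p t → HasEmptyUnpierced τ) := by
  induction N using Nat.strong_induction_on with
  | _ N ih =>
  refine ⟨?_, ?_, ?_⟩
  · rintro k l hkl hl rfl ⟨hs, he, hbetween⟩
    rcases (show k + 1 = l ∨ k + 1 < l by omega) with rfl | hkl'
    · exact hS.hasEmptyUnpierced_box hl hs he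
    by_cases h₁ : ∀ i, k < i → i < l → e i < e k
    · by_cases h₂ : ∀ i, k < i → i < l → s l < s i
      · refine hS.hasEmptyUnpierced_of_shrink hkl' hl ?_ ?_
          (fun i h h' => hs.trans (h₂ i h h').le) h₁ he
        · intro k' c h h' h'' hB
          exact (ih (c - k') (by omega)).1 k' c h' (by omega) rfl hB
        · intro c h h' hH
          exact (ih (c - k) (by omega)).2.2 k c h (by omega) rfl hH
      · push Not at h₂
        obtain ⟨i, hki, hil, hi⟩ := h₂
        obtain ⟨j, hij, hjl, hj, hlast⟩ := exists_last_s12 (P := fun j => s j ≤ s l) hil hi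
        have := h₁ j (by omega) hjl
        exact (ih (l - j) (by omega)).1 j l hjl hl rfl
          ⟨hj, by omega, fun c h h' => .inl (not_le.1 (hlast c h h'))⟩
    · push Not at h₁
      obtain ⟨i, hki, hil, hi⟩ := h₁
      obtain ⟨j, hkj, hji, hj, hfirst⟩ := exists_first (P := fun j => e k ≤ e j) hki hi
      have := hbetween j hkj (by omega)
      exact (ih (j - k) (by omega)).1 k j hkj (by omega) rfl
        ⟨by omega, hj, fun c h h' => .inr (not_le.1 (hfirst c h h'))⟩
  · rintro a b hab hb rfl ⟨hs, he, hec, hbetween⟩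
    by_cases h₁ : ∀ i, a < i → i < b → e i < e a
    · refine hS.hasEmptyUnpierced_of_shrink (l := b + 1) (by omega) hb ?_ ?_
        (fun i h h' => ?_) (fun i h h' => ?_) hec
      · intro k' c h h' h'' hB
        exact (ih (c - k') (by omega)).1 k' c h' (by omega) rfl hB
      · intro c h h' hH
        exact (ih (c - a) (by omega)).2.2 a c h (by omega) rfl hH
      · rcases (show i = b ∨ i < b by omega) with rfl | h'
        · exact hs
        · exact hs.trans (hbetween i h h').le
      · rcases (show i = b ∨ i < b by omega) with rfl | h'
        · exact he
        · exact h₁ i h h'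
    · push Not at h₁
      obtain ⟨i, hai, hib, hi⟩ := h₁
      obtain ⟨j, haj, hji, hj, hfirst⟩ := exists_first (P := fun j => e a ≤ e j) hai hi
      have := hbetween j haj (by omega)
      exact (ih (j - a) (by omega)).1 a j haj (by omega) rfl
        ⟨by omega, hj, fun c h h' => .inr (not_le.1 (hfirst c h h'))⟩
  · rintro p t hpt ht rfl ⟨hs, hst, het, hbetween⟩
    by_cases h₁ : ∀ i, p + 1 < i → i < t → s t < s i
    · obtain ⟨d, rfl⟩ : ∃ d, t = d + 1 := ⟨t - 1, by omega⟩
      have hsd : s (d + 1) < s d := by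
        rcases (show p + 1 = d ∨ p + 1 < d by omega) with rfl | h
        · exact hst
        · exact h₁ d h (by omega)
      have hle : ∀ i, p < i → i ≤ d → e i ≤ e (p + 1) := fun i h h' => by
        rcases (show i = p + 1 ∨ p + 1 < i by omega) with rfl | h
        · exact le_rfl
        · exact (hbetween i h (by omega)).le
      have hed := hle d (by omega) le_rfl
      obtain ⟨c, hpc, hcd, hc, hlast⟩ :=
        exists_last_s12 (P := fun c => s c ≤ s d) (a := p) (b := d) (by omega) (by omega)
      simp only [not_le] at hlast hc
      by_cases hsc : s c ≤ s (d + 1)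
      · exact hS.hasEmptyUnpierced_hex2 hcd ht hsd (by omega) hlast hsc
      · have hpc' : p < c := by
          rcases hpc.eq_or_lt with rfl | h
          · exact absurd hs hsc
          · exact h
        by_cases hec : e c ≤ e d
        · exact (ih (d - c) (by omega)).1 c d hcd (by omega) rfl
            ⟨hc, hec, fun i h h' => .inl (hlast i h h')⟩
        · have := hle c hpc' hcd.le
          exact (ih (d + 1 - c) (by omega)).2.1 c d hcd ht rfl
            ⟨hc, by omega, by omega, hlast⟩
    · push Not at h₁
      obtain ⟨i, hpi, hit, hi⟩ := h₁
      obtain ⟨j, hij, hjt, hj, hlast⟩ := exists_last_s12 (P := fun j => s j ≤ s t) hit hi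
      have := hbetween j (by omega) hjt
      exact (ih (t - j) (by omega)).1 j t hjt ht rfl
        ⟨hj, by omega, fun c h h' => .inl (not_le.1 (hlast c h h'))⟩

theorem bounds (hS : Segmentation τ m s e q) {n : ℕ} (hrange : ∀ x ∈ τ, 1 ≤ x ∧ x ≤ n)
    {k : ℕ} (hk : k < m) : 1 ≤ s k ∧ e k ≤ n := by
  have hle := hS.le k hk
  have key : ∀ j, s k ≤ j → j ≤ e k → 1 ≤ j ∧ j ≤ n := fun j h₁ h₂ => by
    obtain ⟨i, -, rfl⟩ := hS.isDot_of_col (i := q k + j) hk (by omega) h₁ h₂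
    have := hrange _ (List.get_mem τ i)
    omega
  exact ⟨(key (s k) le_rfl hle).1, (key (e k) hle le_rfl).2⟩

/-- Two ascending segments starting at height 1 end at the same height. -/
theorem exists_pair (hS : Segmentation τ m s e q) {n : ℕ} (hrange : ∀ x ∈ τ, 1 ≤ x ∧ x ≤ n)
    (hcount : n < τ.count 1) :
    ∃ k l, k < l ∧ l < m ∧ s k = 1 ∧ s l = 1 ∧ e k = e l := by
  have hcard : τ.count 1 = (Finset.univ.filter fun i : Fin τ.length => τ.get i = 1).card :=
    (Fin.card_filter_univ_eq_vector_get_eq_count 1 ⟨τ, rfl⟩).symm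
  have hcol : ∀ i ∈ Finset.univ.filter fun i : Fin τ.length => τ.get i = 1,
      ∃ k < m, (i : ℤ) = q k ∧ s k = 1 := fun i hi => by
    obtain ⟨k, hk, h₁, h₂, h₃⟩ := (hS.dot_iff (i + 1) (τ.get i : ℤ)).1 ⟨i, rfl, rfl⟩
    have := (Finset.mem_filter.1 hi).2
    have := (hS.bounds hrange hk).1
    exact ⟨k, hk, by omega, by omega⟩
  choose! f hfm hfq hfs using hcol
  obtain ⟨i, hi, j, hj, hij, heq⟩ := Finset.exists_ne_map_eq_of_card_lt_of_maps_to
    (s := Finset.univ.filter fun i : Fin τ.length => τ.get i = 1)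
    (t := Finset.Icc (1 : ℤ) n) (f := fun i => e (f i)) (by rw [← hcard]; simpa using hcount)
    (fun i hi => by
      replace hi := Finset.mem_coe.1 hi
      have h₁ := hS.le _ (hfm i hi)
      rw [hfs i hi] at h₁
      have := (hS.bounds hrange (hfm i hi)).2
      exact Finset.mem_coe.2 (Finset.mem_Icc.2 ⟨h₁, this⟩))
  have hne : f i ≠ f j := fun h => hij <| Fin.ext <| by
    have := hfq i hi
    have := hfq j hj
    rw [← h] at this
    omega
  rcases hne.lt_or_gt with h | h
  · exact ⟨f i, f j, h, hfm j hj, hfs i hi, hfs j hj, heq⟩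
  · exact ⟨f j, f i, h, hfm i hi, hfs j hj, hfs i hi, heq.symm⟩

theorem hasEmptyUnpierced (hS : Segmentation τ m s e q) {n : ℕ}
    (hrange : ∀ x ∈ τ, 1 ≤ x ∧ x ≤ n) (hcount : n < τ.count 1) : HasEmptyUnpierced τ := by
  obtain ⟨k, l, hkl, hl, hk₁, hl₁, he⟩ := hS.exists_pair hrange hcount
  obtain ⟨c, hkc, hcl, ⟨hc₁, hec⟩, hfirst⟩ :=
    exists_first (P := fun c => s c = 1 ∧ e k ≤ e c) hkl ⟨hl₁, he.le⟩
  refine (hS.hasEmptyUnpierced_of_coarse (c - k)).1 k c hkc (by omega) rfl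
    ⟨by omega, hec, fun i h h' => ?_⟩
  have := (hS.bounds hrange (k := i) (by omega)).1
  have := hfirst i h h'
  omega

end Segmentation

/-- If `σ` has all entries in `{1, …, n−1}` (where `n ≥ 2`) and more
than `n−1` entries equal to 1, then a finite sequence of commutations transforms `σ`
into a sequence `τ` in sawtooth form whose dot graph contains an empty unpierced box
or an empty unpierced hexagon of type 1 or 2. -/
theorem exists_sawtooth_with_empty_unpierced (n : ℕ) (hn : 2 ≤ n) (σ : List ℕ)
    (hrange : ∀ x ∈ σ, 1 ≤ x ∧ x ≤ n - 1) (hcount : n - 1 < σ.count 1) :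
    ∃ τ : List ℕ, Relation.ReflTransGen Commutation σ τ ∧ Sawtooth τ ∧
      ∃ P : DGPoly, P.Valid τ ∧ P.Unpierced τ ∧ P.IsEmpty τ := by
  obtain ⟨τ, hστ, hτ⟩ := exists_sawtooth σ
  have hperm := perm_of_reflTransGen_commutation hστ
  obtain ⟨m, s, e, q, hS, -⟩ := exists_segmentation τ ((sawtooth_iff_isChain τ).1 hτ)
  exact ⟨τ, hστ, hτ, hS.hasEmptyUnpierced (fun x hx => hrange x (hperm.mem_iff.2 hx))
    (hperm.count_eq 1 ▸ hcount)⟩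
end
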